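/- Let S, A, s_0, H be as in a layered finite-horizon MDP, let P and P̂ be two dynamics on the same layered state space, let π : S → A be a deterministic policy, and let r : S × A → [0,1]. Then Σ_{h=0}^{H−1} Σ_{s∈S_h} Σ_{a∈A} q_h(s,a|π,P̂) · r(s,a) ≤ 3 · Σ_{h=0}^{H−1} Σ_{s∈S_h} Σ_{a∈A} q_h(s,a|π,P) · r(s,a) + 9H² · Σ_{h=0}^{H−1} Σ_{s∈S_h} Σ_{a∈A} q_h(s,a|π,P) · D_H²(P(·|s,a), P̂(·|s,a)). -/

import Mathlib

open scoped BigOperators Classical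
open Finset

noncomputable section

/-- Squared Hellinger distance between two distributions on a finite set. -/
def hellingerSq {X : Type*} [Fintype X] (P Q : X → ℝ) : ℝ :=
  ∑ x, (Real.sqrt (P x) - Real.sqrt (Q x)) ^ 2

variable {S : ℕ → Type} [∀ h, Fintype (S h)] {A : Type} [Fintype A]

/-- Value function of a deterministic policy in a layered MDP, defined by the backward
Bellman recursion: `val P r pol k h s` is the value with `k` steps to go, starting at
state `s` in layer `h`.  The layer-`h` value function of the horizon-`H` MDP is
`val P r pol (H - h) h`. -/
def val (P : ∀ h, S h → A → S (h + 1) → ℝ) (r : ∀ h, S h → A → ℝ)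
    (pol : ∀ h, S h → A) : (k : ℕ) → (h : ℕ) → S h → ℝ
  | 0, _, _ => 0
  | k + 1, h, s =>
      r h s (pol h s) + ∑ s' : S (h + 1), P h s (pol h s) s' * val P r pol k (h + 1) s'

/-- State-occupancy measure: `stateOcc P pol h0 st k s` is the probability of being at
state `s` in layer `h0 + k` when acting with the deterministic policy `pol` under
dynamics `P`, starting from state `st` in layer `h0`. -/
def stateOcc (P : ∀ h, S h → A → S (h + 1) → ℝ) (pol : ∀ h, S h → A)
    (h0 : ℕ) (st : S h0) : (k : ℕ) → S (h0 + k) → ℝ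
  | 0, s => if s = st then 1 else 0
  | k + 1, s' =>
      ∑ s : S (h0 + k), stateOcc P pol h0 st k s * P (h0 + k) s (pol (h0 + k) s) s'

/-- State-action occupancy measure started at `st` in layer `h0`. -/
def occ (P : ∀ h, S h → A → S (h + 1) → ℝ) (pol : ∀ h, S h → A)
    (h0 : ℕ) (st : S h0) (k : ℕ) (s : S (h0 + k)) (a : A) : ℝ :=
  if a = pol (h0 + k) s then stateOcc P pol h0 st k s else 0

/-- State-occupancy measure started from the initial state `s0` of layer `0`:
probability of being at state `s` in layer `h`. -/
def stateOcc0 (P : ∀ h, S h → A → S (h + 1) → ℝ) (pol : ∀ h, S h → A)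
    (s0 : S 0) : (h : ℕ) → S h → ℝ
  | 0, s => if s = s0 then 1 else 0
  | h + 1, s' => ∑ s : S h, stateOcc0 P pol s0 h s * P h s (pol h s) s'

/-- State-action occupancy measure `q_h(s, a | pol, P)` started from the initial state. -/
def occ0 (P : ∀ h, S h → A → S (h + 1) → ℝ) (pol : ∀ h, S h → A)
    (s0 : S 0) (h : ℕ) (s : S h) (a : A) : ℝ :=
  if a = pol h s then stateOcc0 P pol s0 h s else 0


/-- Change of measure by Young's inequality, in terms of the square roots of the densities. -/
lemma sum_mul_le_add_hellingerSq {X : Type*} [Fintype X] {p q f : X → ℝ} {ε R : ℝ}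
    (hε : 0 < ε) (hp : ∀ x, 0 ≤ p x) (hq : ∀ x, 0 ≤ q x)
    (hf0 : ∀ x, 0 ≤ f x) (hfR : ∀ x, f x ≤ R) :
    ∑ x, q x * f x ≤ (1 + ε) * ∑ x, p x * f x + R * (1 + ε⁻¹) * hellingerSq p q := by
  unfold hellingerSq
  rw [Finset.mul_sum, Finset.mul_sum, ← Finset.sum_add_distrib]
  refine Finset.sum_le_sum fun x _ => ?_
  have young : q x ≤ (1 + ε) * p x + (1 + ε⁻¹) * (√(p x) - √(q x)) ^ 2 := by
    have key : (1 + ε) * √(p x) ^ 2 + (1 + ε⁻¹) * (√(p x) - √(q x)) ^ 2 - √(q x) ^ 2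
        = ε⁻¹ * (ε * √(p x) + √(p x) - √(q x)) ^ 2 := by
      field_simp
      ring
    have hnonneg : 0 ≤ ε⁻¹ * (ε * √(p x) + √(p x) - √(q x)) ^ 2 := by positivity
    rw [← key, Real.sq_sqrt (hp x), Real.sq_sqrt (hq x)] at hnonneg
    linarith
  have hD : 0 ≤ (1 + ε⁻¹) * (√(p x) - √(q x)) ^ 2 := by positivity
  nlinarith [mul_le_mul_of_nonneg_right young (hf0 x), mul_le_mul_of_nonneg_right (hfR x) hD]

lemma hellingerSq_nonneg {X : Type*} [Fintype X] (p q : X → ℝ) : 0 ≤ hellingerSq p q :=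
  Finset.sum_nonneg fun _ _ => sq_nonneg _

lemma sum_occ0_mul (P : ∀ h, S h → A → S (h + 1) → ℝ) (pol : ∀ h, S h → A) (s0 : S 0)
    (h : ℕ) (f : S h → A → ℝ) :
    ∑ s, ∑ a, occ0 P pol s0 h s a * f s a = ∑ s, stateOcc0 P pol s0 h s * f s (pol h s) := by
  simp [occ0, ite_mul]

omit [Fintype A] in
lemma stateOcc0_nonneg {P : ∀ h, S h → A → S (h + 1) → ℝ} {H : ℕ}
    (hP0 : ∀ h, h < H → ∀ s a s', 0 ≤ P h s a s') (pol : ∀ h, S h → A) (s0 : S 0) :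
    ∀ h, h ≤ H → ∀ s, 0 ≤ stateOcc0 P pol s0 h s
  | 0, _, s => by
    unfold stateOcc0
    split_ifs <;> norm_num
  | h + 1, hh, s' => by
    unfold stateOcc0
    exact Finset.sum_nonneg fun s _ =>
      mul_nonneg (stateOcc0_nonneg hP0 pol s0 h (by omega) s) (hP0 h (by omega) _ _ _)

omit [Fintype A] in
lemma sum_stateOcc0_succ_mul (P : ∀ h, S h → A → S (h + 1) → ℝ) (pol : ∀ h, S h → A) (s0 : S 0)
    (h : ℕ) (f : S (h + 1) → ℝ) :
    ∑ s', stateOcc0 P pol s0 (h + 1) s' * f s' =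
      ∑ s, stateOcc0 P pol s0 h s * ∑ s', P h s (pol h s) s' * f s' := by
  simp only [stateOcc0, Finset.sum_mul, Finset.mul_sum]
  rw [Finset.sum_comm]
  simp only [mul_assoc]

omit [Fintype A] in
lemma val_sub_eq (P : ∀ h, S h → A → S (h + 1) → ℝ) (r : ∀ h, S h → A → ℝ)
    (pol : ∀ h, S h → A) {H h : ℕ} (hh : h < H) (s : S h) :
    val P r pol (H - h) h s =
      r h s (pol h s) + ∑ s', P h s (pol h s) s' * val P r pol (H - (h + 1)) (h + 1) s' := by
  rw [show H - h = (H - (h + 1)) + 1 by omega, _root_.val]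

omit [Fintype A] in
lemma val_nonneg_and_le {P : ∀ h, S h → A → S (h + 1) → ℝ} {r : ∀ h, S h → A → ℝ} {H : ℕ}
    (hP0 : ∀ h, h < H → ∀ s a s', 0 ≤ P h s a s')
    (hP1 : ∀ h, h < H → ∀ s a, (∑ s', P h s a s') = 1)
    (hr : ∀ h s a, 0 ≤ r h s a ∧ r h s a ≤ 1) (pol : ∀ h, S h → A) :
    ∀ k h, h + k ≤ H → ∀ s, 0 ≤ val P r pol k h s ∧ val P r pol k h s ≤ k
  | 0, h, _, s => by simp [_root_.val]
  | k + 1, h, hh, s => by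
    have ih := val_nonneg_and_le hP0 hP1 hr pol k (h + 1) (by omega)
    have hlt : h < H := by omega
    have h0 : 0 ≤ ∑ s', P h s (pol h s) s' * val P r pol k (h + 1) s' :=
      Finset.sum_nonneg fun s' _ => mul_nonneg (hP0 h hlt _ _ _) (ih s').1
    have h1 : ∑ s', P h s (pol h s) s' * val P r pol k (h + 1) s' ≤ k :=
      calc _ ≤ ∑ s', P h s (pol h s) s' * (k : ℝ) :=
            Finset.sum_le_sum fun s' _ => mul_le_mul_of_nonneg_left (ih s').2 (hP0 h hlt _ _ _)
        _ = k := by rw [← Finset.sum_mul, hP1 h hlt, one_mul]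
    obtain ⟨hr0, hr1⟩ := hr h s (pol h s)
    rw [_root_.val]
    push_cast
    constructor <;> linarith

omit [Fintype A] in
/-- The value at the initial state is the reward collected before layer `n` plus the expected
value at layer `n`. -/
lemma sum_stateOcc0_mul_reward_add (P : ∀ h, S h → A → S (h + 1) → ℝ) (r : ∀ h, S h → A → ℝ)
    (pol : ∀ h, S h → A) (s0 : S 0) {H : ℕ} (n : ℕ) (hn : n ≤ H) :
    ∑ h ∈ Finset.range n, ∑ s, stateOcc0 P pol s0 h s * r h s (pol h s)
      + ∑ s, stateOcc0 P pol s0 n s * val P r pol (H - n) n s = val P r pol H 0 s0 := by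
  induction n with
  | zero => simp [stateOcc0]
  | succ n ih =>
    rw [← ih (by omega), Finset.sum_range_succ, sum_stateOcc0_succ_mul, add_assoc,
      ← Finset.sum_add_distrib]
    simp only [val_sub_eq P r pol (show n < H by omega), mul_add]

omit [Fintype A] in
/-- A value function under `Q` is bounded by inflated rewards and Hellinger errors collected
under `P`. -/
lemma val_le_sum_stateOcc0 {P Q : ∀ h, S h → A → S (h + 1) → ℝ} {r : ∀ h, S h → A → ℝ} {H : ℕ}
    {ε : ℝ} (hε : 0 < ε)
    (hP0 : ∀ h, h < H → ∀ s a s', 0 ≤ P h s a s')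
    (hQ0 : ∀ h, h < H → ∀ s a s', 0 ≤ Q h s a s')
    (hQ1 : ∀ h, h < H → ∀ s a, (∑ s', Q h s a s') = 1)
    (hr : ∀ h s a, 0 ≤ r h s a ∧ r h s a ≤ 1) (pol : ∀ h, S h → A) (s0 : S 0)
    (n : ℕ) (hn : n ≤ H) :
    val Q r pol H 0 s0 ≤
      ∑ h ∈ Finset.range n, (1 + ε) ^ h * ∑ s, stateOcc0 P pol s0 h s *
          (r h s (pol h s) + H * (1 + ε⁻¹) * hellingerSq (P h s (pol h s)) (Q h s (pol h s)))
        + (1 + ε) ^ n * ∑ s, stateOcc0 P pol s0 n s * val Q r pol (H - n) n s := by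
  induction n with
  | zero => simp [stateOcc0]
  | succ n ih =>
    have hlt : n < H := by omega
    refine (ih hlt.le).trans ?_
    rw [Finset.sum_range_succ, sum_stateOcc0_succ_mul, add_assoc]
    refine add_le_add_right ?_ _
    rw [pow_succ, mul_assoc, ← mul_add]
    refine mul_le_mul_of_nonneg_left ?_ (by positivity)
    rw [Finset.mul_sum, ← Finset.sum_add_distrib]
    refine Finset.sum_le_sum fun s _ => ?_
    rw [mul_left_comm, ← mul_add]
    refine mul_le_mul_of_nonneg_left ?_ (stateOcc0_nonneg hP0 pol s0 n hlt.le s)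
    have hval := val_nonneg_and_le hQ0 hQ1 hr pol (H - (n + 1)) (n + 1) (by omega)
    have step := sum_mul_le_add_hellingerSq hε (hP0 n hlt s (pol n s)) (hQ0 n hlt s (pol n s))
      (fun s' => (hval s').1)
      (fun s' => (hval s').2.trans (Nat.cast_le.mpr (Nat.sub_le H (n + 1))))
    rw [val_sub_eq Q r pol hlt]
    linarith

lemma one_add_inv_pow_le_three {H h : ℕ} (hH : 1 ≤ H) (hh : h ≤ H) :
    (1 + (H : ℝ)⁻¹) ^ h ≤ 3 := by
  have hH' : (H : ℝ) ≠ 0 := by positivity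
  calc (1 + (H : ℝ)⁻¹) ^ h ≤ (1 + (H : ℝ)⁻¹) ^ H :=
        pow_le_pow_right₀ (le_add_of_nonneg_right (by positivity)) hh
    _ ≤ Real.exp (H : ℝ)⁻¹ ^ H := by
        gcongr
        linarith [Real.add_one_le_exp (H : ℝ)⁻¹]
    _ = Real.exp 1 := by rw [← Real.exp_nat_mul, mul_inv_cancel₀ hH']
    _ ≤ 3 := by linarith [Real.exp_one_lt_d9]

/-- Occupancy-measure change of measure (`corl:occupancy-change-of-measure`):
`Σ_h Σ_s Σ_a q_h(s,a|π,P̂) r(s,a) ≤ 3 Σ_h Σ_s Σ_a q_h(s,a|π,P) r(s,a)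
  + 9H² Σ_h Σ_s Σ_a q_h(s,a|π,P) D_H²(P(·|s,a), P̂(·|s,a))`. -/
theorem stmt6
    (H : ℕ) (hH : 1 ≤ H)
    (s0 : S 0) (hS0 : ∀ s : S 0, s = s0)
    (P Phat : ∀ h, S h → A → S (h + 1) → ℝ)
    (hP0 : ∀ h, h < H → ∀ s a s', 0 ≤ P h s a s')
    (hP1 : ∀ h, h < H → ∀ s a, (∑ s', P h s a s') = 1)
    (hPhat0 : ∀ h, h < H → ∀ s a s', 0 ≤ Phat h s a s')
    (hPhat1 : ∀ h, h < H → ∀ s a, (∑ s', Phat h s a s') = 1)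
    (pol : ∀ h, S h → A)
    (r : ∀ h, S h → A → ℝ)
    (hr : ∀ h s a, 0 ≤ r h s a ∧ r h s a ≤ 1) :
    (∑ h ∈ Finset.range H, ∑ s : S h, ∑ a : A, occ0 Phat pol s0 h s a * r h s a) ≤
      3 * (∑ h ∈ Finset.range H, ∑ s : S h, ∑ a : A, occ0 P pol s0 h s a * r h s a) +
        9 * (H : ℝ) ^ 2 *
          ∑ h ∈ Finset.range H, ∑ s : S h, ∑ a : A,
            occ0 P pol s0 h s a * hellingerSq (P h s a) (Phat h s a) := by
  have hH1 : (1 : ℝ) ≤ H := by exact_mod_cast hH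
  have hreturn := sum_stateOcc0_mul_reward_add Phat r pol s0 H le_rfl
  have hbound := val_le_sum_stateOcc0 (inv_pos.mpr (by linarith : (0 : ℝ) < H))
    hP0 hPhat0 hPhat1 hr pol s0 H le_rfl
  simp only [Nat.sub_self, _root_.val, mul_zero, Finset.sum_const_zero, add_zero, inv_inv]
    at hreturn hbound
  simp only [sum_occ0_mul]
  rw [hreturn]
  refine hbound.trans ?_
  simp only [Finset.mul_sum]
  rw [← Finset.sum_add_distrib]
  refine Finset.sum_le_sum fun h hh => ?_
  rw [← Finset.sum_add_distrib]
  refine Finset.sum_le_sum fun s _ => ?_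
  have hh' : h ≤ H := (Finset.mem_range.mp hh).le
  have hocc := stateOcc0_nonneg hP0 pol s0 h hh' s
  have hr0 := (hr h s (pol h s)).1
  have hD := hellingerSq_nonneg (P h s (pol h s)) (Phat h s (pol h s))
  generalize hellingerSq (P h s (pol h s)) (Phat h s (pol h s)) = D at hD ⊢
  have hcoef : (H : ℝ) * (1 + H) ≤ 3 * H ^ 2 := by nlinarith
  calc (1 + (H : ℝ)⁻¹) ^ h * (stateOcc0 P pol s0 h s * (r h s (pol h s) + H * (1 + H) * D))
      ≤ 3 * (stateOcc0 P pol s0 h s * (r h s (pol h s) + 3 * H ^ 2 * D)) := by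
        have := one_add_inv_pow_le_three hH hh'
        gcongr
    _ = _ := by ring


end
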